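/- arXiv:1001.0875 — 2 statements merged into one kernel-verified Lean document; each statement's English description precedes it below -/
import Mathlib

section
/- There exists a universal constant C > 0 such that for any n ≥ 1, σ̲_n ≤ C σ_n. -/
open MeasureTheory Real Set Filter Topology RealInnerProductSpace
noncomputable section

abbrev EucSp (n : ℕ) := EuclideanSpace ℝ (Fin n)

/-- A nonnegative function is log-concave. -/
def IsLogConcaveFn {n : ℕ} (f : EucSp n → ℝ) : Prop :=
  (∀ x, 0 ≤ f x) ∧ ∀ x y : EucSp n, ∀ l : ℝ, l ∈ Set.Icc (0:ℝ) 1 →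
    f x ^ (1 - l) * f y ^ l ≤ f ((1 - l) • x + l • y)

/-- A measure is log-concave if it has a log-concave density w.r.t. Lebesgue measure. -/
def IsLogConcave {n : ℕ} (μ : Measure (EucSp n)) : Prop :=
  ∃ f : EucSp n → ℝ, IsLogConcaveFn f ∧
    μ = volume.withDensity (fun x => ENNReal.ofReal (f x))

/-- Barycenter at the origin and covariance matrix equal to the identity. -/
def IsIsotropic {n : ℕ} (μ : Measure (EucSp n)) : Prop :=
  (∫ x, x ∂μ = 0) ∧ ∀ u v : EucSp n, (∫ x, ⟪x, u⟫ * ⟪x, v⟫ ∂μ) = ⟪u, v⟫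

/-- σ_n² = sup over isotropic log-concave random vectors of E (|X| - √n)². -/
def sigmaNSq (n : ℕ) : ℝ :=
  sSup {v | ∃ μ : Measure (EucSp n), IsProbabilityMeasure μ ∧ IsIsotropic μ ∧
    IsLogConcave μ ∧ v = ∫ x, (‖x‖ - Real.sqrt n) ^ 2 ∂μ}

def sigmaN (n : ℕ) : ℝ := Real.sqrt (sigmaNSq n)

/-- σ̲_n = (1/√n) sup over isotropic log-concave random vectors of |E X |X|²|. -/
def sigmaBar (n : ℕ) : ℝ :=
  (Real.sqrt n)⁻¹ * sSup {v | ∃ μ : Measure (EucSp n), IsProbabilityMeasure μ ∧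
    IsIsotropic μ ∧ IsLogConcave μ ∧ v = ‖∫ x, (‖x‖ ^ 2) • x ∂μ‖}

/-- L_n = sup over isotropic log-concave probability densities f on ℝⁿ of f(0)^{1/n}. -/
def LN (n : ℕ) : ℝ :=
  sSup {l | ∃ (μ : Measure (EucSp n)) (f : EucSp n → ℝ),
    IsProbabilityMeasure μ ∧ IsIsotropic μ ∧ IsLogConcaveFn f ∧
    μ = volume.withDensity (fun x => ENNReal.ofReal (f x)) ∧
    l = f 0 ^ ((n : ℝ)⁻¹)}

open scoped ENNReal Pointwise

/-- One-dimensional Brunn–Minkowski inequality. -/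
theorem Real.volume_add_volume_le {A B C : Set ℝ} (hA : MeasurableSet A) (hB : MeasurableSet B)
    (hA0 : A.Nonempty) (hB0 : B.Nonempty) (hC : ∀ x ∈ A, ∀ y ∈ B, x + y ∈ C) :
    volume A + volume B ≤ volume C := by
  obtain ⟨x₀, hx₀⟩ := hA0
  obtain ⟨y₀, hy₀⟩ := hB0
  by_cases hCt : volume C = ∞
  · simp [hCt]
  have hAC : volume A ≤ volume C := by
    rw [← measure_preimage_add_right volume (-y₀) A]
    refine measure_mono fun z hz => ?_
    have := hC _ hz _ hy₀
    simpa using this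
  have hBC : volume B ≤ volume C := by
    rw [← measure_preimage_add_right volume (-x₀) B]
    refine measure_mono fun z hz => ?_
    have := hC _ hx₀ _ hz
    simpa using this
  refine ENNReal.le_of_forall_pos_le_add fun ε hε _ => ?_
  have hε2 : (ε / 2 : ℝ≥0∞) ≠ 0 := by simpa using hε.ne'
  obtain ⟨K, hKA, hK, hKm⟩ := hA.exists_isCompact_lt_add (ne_top_of_le_ne_top hCt hAC) hε2
  obtain ⟨L, hLB, hL, hLm⟩ := hB.exists_isCompact_lt_add (ne_top_of_le_ne_top hCt hBC) hε2
  have key : volume K + volume L ≤ volume C := by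
    rcases K.eq_empty_or_nonempty with rfl | hK0
    · simpa using (measure_mono hLB).trans hBC
    rcases L.eq_empty_or_nonempty with rfl | hL0
    · simpa using (measure_mono hKA).trans hAC
    obtain ⟨k, hk, hkmax⟩ := hK.exists_isGreatest hK0
    obtain ⟨l, hl, hlmin⟩ := hL.exists_isLeast hL0
    rw [← measure_preimage_add_right volume (-l) K, ← measure_preimage_add_right volume (-k) L]
    rw [← measure_union₀]
    · refine measure_mono ?_
      rintro z (hz | hz)
      · simpa using hC _ (hKA hz) _ (hLB hl)
      · simpa using hC _ (hKA hk) _ (hLB hz)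
    · exact (measurable_add_const (-k) hL.measurableSet).nullMeasurableSet
    · refine measure_mono_null (t := {k + l}) ?_ (by simp)
      rintro z ⟨h1, h2⟩
      have h1' := hkmax h1
      have h2' := hlmin h2
      rw [Set.mem_singleton_iff]
      linarith
  calc volume A + volume B ≤ (volume K + ε / 2) + (volume L + ε / 2) := by gcongr
    _ = (volume K + volume L) + ε := by rw [add_add_add_comm, ENNReal.add_halves]
    _ ≤ volume C + ε := by gcongr

theorem Real.smul_volume_add_smul_volume_le {A B C : Set ℝ} {a b : ℝ} (ha : 0 < a) (hb : 0 < b)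
    (hA : MeasurableSet A) (hB : MeasurableSet B) (hA0 : A.Nonempty) (hB0 : B.Nonempty)
    (hC : ∀ x ∈ A, ∀ y ∈ B, a * x + b * y ∈ C) :
    ENNReal.ofReal a * volume A + ENNReal.ofReal b * volume B ≤ volume C := by
  have h := Real.volume_add_volume_le (hA.const_smul₀ a) (hB.const_smul₀ b)
    (hA0.smul_set (a := a)) (hB0.smul_set (a := b)) (C := C) (by
      rintro _ ⟨x, hx, rfl⟩ _ ⟨y, hy, rfl⟩
      exact hC x hx y hy)
  simpa [Measure.addHaar_smul, abs_of_pos ha, abs_of_pos hb] using h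

theorem ENNReal.lintegral_eq_lintegral_meas_lt_of_le_one {f : ℝ → ℝ≥0∞} (hf : Measurable f)
    (h1 : ∀ x, f x ≤ 1) :
    ∫⁻ x, f x = ∫⁻ t in Ioo (0 : ℝ) 1, volume {x | ENNReal.ofReal t < f x} := by
  have hfin : ∀ x, f x ≠ ∞ := fun x => ne_top_of_le_ne_top one_ne_top (h1 x)
  have h := lintegral_eq_lintegral_meas_lt (f := fun x => (f x).toReal) volume
    (ae_of_all _ fun x => ENNReal.toReal_nonneg) hf.ennreal_toReal.aemeasurable
  simp only [ENNReal.ofReal_toReal (hfin _)] at h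
  rw [h, ← Ioo_union_Ici_eq_Ioi (zero_lt_one (α := ℝ)),
    lintegral_union measurableSet_Ici (Set.disjoint_left.2 fun x hx hx' => hx.2.not_ge hx')]
  have h0 : ∫⁻ t in Ici (1 : ℝ), volume {x | t < (f x).toReal} = 0 := by
    rw [setLIntegral_congr_fun (g := fun _ => 0) measurableSet_Ici]
    · simp
    intro t ht
    have : {x | t < (f x).toReal} = ∅ := by
      ext x
      have := ENNReal.toReal_mono one_ne_top (h1 x)
      simp only [ENNReal.toReal_one] at this
      simpa using this.trans ht
    simp [this]
  rw [h0, add_zero]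
  refine setLIntegral_congr_fun measurableSet_Ioo fun t ht => ?_
  simp only [ENNReal.ofReal_lt_iff_lt_toReal ht.1.le (hfin _)]

theorem ENNReal.rpow_mul_rpow_le_add {a b : ℝ} (ha : 0 < a) (hb : 0 < b) (hab : a + b = 1)
    (x y : ℝ≥0∞) : x ^ a * y ^ b ≤ ENNReal.ofReal a * x + ENNReal.ofReal b * y := by
  rcases eq_or_ne x ∞ with rfl | hx
  · simp [ENNReal.mul_top, ha]
  rcases eq_or_ne y ∞ with rfl | hy
  · simp [ENNReal.mul_top, hb]
  lift x to NNReal using hx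
  lift y to NNReal using hy
  have h := Real.geom_mean_le_arith_mean2_weighted ha.le hb.le x.coe_nonneg y.coe_nonneg hab
  rw [← ENNReal.ofReal_coe_nnreal, ← ENNReal.ofReal_coe_nnreal, ENNReal.ofReal_rpow_of_nonneg x.coe_nonneg ha.le,
    ENNReal.ofReal_rpow_of_nonneg y.coe_nonneg hb.le, ← ENNReal.ofReal_mul ha.le, ← ENNReal.ofReal_mul hb.le,
    ← ENNReal.ofReal_mul (by positivity), ← ENNReal.ofReal_add (by positivity) (by positivity)]
  exact ENNReal.ofReal_le_ofReal h

theorem ENNReal.lt_rpow_mul_rpow {a b : ℝ} (ha : 0 < a) (hb : 0 < b) (hab : a + b = 1)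
    {x y t : ℝ≥0∞} (hx : t < x) (hy : t < y) : t < x ^ a * y ^ b := by
  have hm : t < min x y := lt_min hx hy
  refine hm.trans_le ?_
  calc min x y = min x y ^ a * min x y ^ b := by
        rw [← ENNReal.rpow_add_of_nonneg _ _ ha.le hb.le, hab, ENNReal.rpow_one]
    _ ≤ x ^ a * y ^ b := by
        gcongr
        · exact min_le_left _ _
        · exact min_le_right _ _

theorem lintegral_add_le_of_iSup_eq_one {f g h : ℝ → ℝ≥0∞} {a b : ℝ} (ha : 0 < a) (hb : 0 < b)
    (hab : a + b = 1) (hf : Measurable f) (hg : Measurable g) (hh : Measurable h)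
    (hf1 : ⨆ x, f x = 1) (hg1 : ⨆ x, g x = 1)
    (hfgh : ∀ x y, f x ^ a * g y ^ b ≤ h (a * x + b * y)) :
    ENNReal.ofReal a * (∫⁻ x, f x) + ENNReal.ofReal b * (∫⁻ x, g x) ≤ ∫⁻ x, h x := by
  have hf1' : ∀ x, f x ≤ 1 := fun x => hf1 ▸ le_iSup f x
  have hg1' : ∀ x, g x ≤ 1 := fun x => hg1 ▸ le_iSup g x
  refine le_trans ?_ (lintegral_mono (fun x => min_le_left (h x) 1))
  have hh' : Measurable fun x => min (h x) 1 := hh.min measurable_const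
  rw [ENNReal.lintegral_eq_lintegral_meas_lt_of_le_one hf hf1',
    ENNReal.lintegral_eq_lintegral_meas_lt_of_le_one hg hg1',
    ENNReal.lintegral_eq_lintegral_meas_lt_of_le_one hh' (fun x => min_le_right _ _)]
  rw [← lintegral_const_mul' _ _ ENNReal.ofReal_ne_top,
    ← lintegral_const_mul' _ _ ENNReal.ofReal_ne_top]
  refine (le_lintegral_add _ _).trans ?_
  refine setLIntegral_mono' measurableSet_Ioo fun t ht => ?_
  have ht1 : ENNReal.ofReal t < 1 := by simpa using ht.2
  have hfn : ∃ x, ENNReal.ofReal t < f x := lt_iSup_iff.1 (by rwa [hf1])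
  have hgn : ∃ x, ENNReal.ofReal t < g x := lt_iSup_iff.1 (by rwa [hg1])
  refine Real.smul_volume_add_smul_volume_le ha hb (hf measurableSet_Ioi) (hg measurableSet_Ioi)
    hfn hgn fun x hx y hy => ?_
  exact lt_min ((ENNReal.lt_rpow_mul_rpow ha hb hab hx hy).trans_le (hfgh x y)) ht1

/-- One-dimensional Prékopa–Leindler inequality for bounded functions. -/
theorem prekopa_leindler_of_iSup_ne_top {f g h : ℝ → ℝ≥0∞} {a b : ℝ} (ha : 0 < a) (hb : 0 < b)
    (hab : a + b = 1) (hf : Measurable f) (hg : Measurable g) (hh : Measurable h)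
    (hft : ⨆ x, f x ≠ ∞) (hgt : ⨆ x, g x ≠ ∞)
    (hfgh : ∀ x y, f x ^ a * g y ^ b ≤ h (a * x + b * y)) :
    (∫⁻ x, f x) ^ a * (∫⁻ x, g x) ^ b ≤ ∫⁻ x, h x := by
  set A := ⨆ x, f x with hA
  set B := ⨆ x, g x with hB
  rcases eq_or_ne A 0 with hA0 | hA0
  · have : ∀ x, f x = 0 := fun x => le_zero_iff.1 (hA0 ▸ le_iSup f x)
    simp [this, ha]
  rcases eq_or_ne B 0 with hB0 | hB0
  · have : ∀ x, g x = 0 := fun x => le_zero_iff.1 (hB0 ▸ le_iSup g x)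
    simp [this, hb]
  have hc0 : A ^ a * B ^ b ≠ 0 := by
    simp [ENNReal.rpow_eq_zero_iff, hA0, hB0, hft, hgt]
  have hct : A ^ a * B ^ b ≠ ∞ := ENNReal.mul_ne_top
    (ENNReal.rpow_ne_top_of_nonneg ha.le hft) (ENNReal.rpow_ne_top_of_nonneg hb.le hgt)
  have key := lintegral_add_le_of_iSup_eq_one ha hb hab (hf.const_mul A⁻¹) (hg.const_mul B⁻¹)
    (hh.const_mul (A ^ a * B ^ b)⁻¹)
    (by rw [← ENNReal.mul_iSup, ← hA, ENNReal.inv_mul_cancel hA0 hft])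
    (by rw [← ENNReal.mul_iSup, ← hB, ENNReal.inv_mul_cancel hB0 hgt])
    (fun x y => by
      rw [ENNReal.mul_rpow_of_nonneg _ _ ha.le, ENNReal.mul_rpow_of_nonneg _ _ hb.le,
        mul_mul_mul_comm, ENNReal.inv_rpow, ENNReal.inv_rpow,
        ← ENNReal.mul_inv (Or.inr (ENNReal.rpow_ne_top_of_nonneg hb.le hgt))
          (Or.inl (ENNReal.rpow_ne_top_of_nonneg ha.le hft))]
      gcongr
      exact hfgh x y)
  have key2 := (ENNReal.rpow_mul_rpow_le_add ha hb hab _ _).trans key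
  rw [lintegral_const_mul _ hf, lintegral_const_mul _ hg, lintegral_const_mul _ hh,
    ENNReal.mul_rpow_of_nonneg _ _ ha.le, ENNReal.mul_rpow_of_nonneg _ _ hb.le,
    mul_mul_mul_comm, ENNReal.inv_rpow, ENNReal.inv_rpow,
    ← ENNReal.mul_inv (Or.inr (ENNReal.rpow_ne_top_of_nonneg hb.le hgt))
      (Or.inl (ENNReal.rpow_ne_top_of_nonneg ha.le hft))] at key2
  exact (ENNReal.mul_le_mul_iff_right (ENNReal.inv_ne_zero.2 hct) (ENNReal.inv_ne_top.2 hc0)).1 key2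

/-- One-dimensional Prékopa–Leindler inequality. -/
theorem prekopa_leindler {f g h : ℝ → ℝ≥0∞} {a b : ℝ} (ha : 0 < a) (hb : 0 < b)
    (hab : a + b = 1) (hf : Measurable f) (hg : Measurable g) (hh : Measurable h)
    (hfgh : ∀ x y, f x ^ a * g y ^ b ≤ h (a * x + b * y)) :
    (∫⁻ x, f x) ^ a * (∫⁻ x, g x) ^ b ≤ ∫⁻ x, h x := by
  have trunc : ∀ u : ℝ → ℝ≥0∞, Measurable u →
      Tendsto (fun k : ℕ => ∫⁻ x, min (u x) k) atTop (𝓝 (∫⁻ x, u x)) := by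
    intro u hu
    refine lintegral_tendsto_of_tendsto_of_monotone
      (fun k => (hu.min measurable_const).aemeasurable) (ae_of_all _ fun x => ?_)
      (ae_of_all _ fun x => ?_)
    · intro i j hij
      exact min_le_min le_rfl (by exact_mod_cast hij)
    · simpa using (tendsto_const_nhds (x := u x)).min ENNReal.tendsto_nat_nhds_top
  have bdd : ∀ (u : ℝ → ℝ≥0∞) (k : ℕ), ⨆ x, min (u x) k ≠ ∞ := fun u k =>
    ne_top_of_le_ne_top (ENNReal.natCast_ne_top k) (iSup_le fun x => min_le_right _ _)
  rcases eq_or_ne (∫⁻ x, f x) 0 with hf0 | hf0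
  · simp [hf0, ha]
  rcases eq_or_ne (∫⁻ x, g x) 0 with hg0 | hg0
  · simp [hg0, hb]
  refine le_of_tendsto (ENNReal.Tendsto.mul
    ((ENNReal.continuous_rpow_const (y := a)).tendsto _ |>.comp (trunc f hf))
    (Or.inl ?_) ((ENNReal.continuous_rpow_const (y := b)).tendsto _ |>.comp (trunc g hg))
    (Or.inl ?_)) (Eventually.of_forall fun k => ?_)
  · simp [ENNReal.rpow_eq_zero_iff, hf0, ha.le]
  · simp [ENNReal.rpow_eq_zero_iff, hg0, hb.le]
  · refine prekopa_leindler_of_iSup_ne_top ha hb hab (hf.min measurable_const)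
      (hg.min measurable_const) hh (bdd f k) (bdd g k) fun x y => le_trans ?_ (hfgh x y)
    gcongr <;> exact min_le_left _ _

/-- Log-concavity of an extended-nonnegative-valued function on a real vector space. -/
def ELogConcave {E : Type*} [AddCommGroup E] [Module ℝ E] (F : E → ℝ≥0∞) : Prop :=
  ∀ x y : E, ∀ a b : ℝ, 0 < a → 0 < b → a + b = 1 → F x ^ a * F y ^ b ≤ F (a • x + b • y)

theorem ELogConcave.convex_lt {E : Type*} [AddCommGroup E] [Module ℝ E] {F : E → ℝ≥0∞}
    (hF : ELogConcave F) (t : ℝ≥0∞) : Convex ℝ {x | t < F x} := by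
  rw [convex_iff_forall_pos]
  intro x hx y hy a b ha hb hab
  exact (ENNReal.lt_rpow_mul_rpow ha hb hab hx hy).trans_le (hF x y a b ha hb hab)

theorem ELogConcave.aemeasurable {E : Type*} [NormedAddCommGroup E] [NormedSpace ℝ E]
    [MeasurableSpace E] [BorelSpace E] [FiniteDimensional ℝ E] {F : E → ℝ≥0∞}
    (hF : ELogConcave F) (μ : Measure E) [μ.IsAddHaarMeasure] : AEMeasurable F μ := by
  refine NullMeasurable.aemeasurable ?_
  rw [nullMeasurable_iff_eventuallyMeasurable]
  exact measurable_of_Ioi fun t => (hF.convex_lt t).nullMeasurableSet μ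

theorem ELogConcave.measurable {F : ℝ → ℝ≥0∞} (hF : ELogConcave F) : Measurable F :=
  measurable_of_Ioi fun t => (hF.convex_lt t).ordConnected.measurableSet

theorem ELogConcave.comp_linearMap {E E' : Type*} [AddCommGroup E] [Module ℝ E]
    [AddCommGroup E'] [Module ℝ E'] {F : E' → ℝ≥0∞} (hF : ELogConcave F) (L : E →ₗ[ℝ] E') :
    ELogConcave fun x => F (L x) := by
  intro x y a b ha hb hab
  simpa using hF (L x) (L y) a b ha hb hab

theorem ELogConcave.comp_prodMk {E E' : Type*} [AddCommGroup E] [Module ℝ E]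
    [AddCommGroup E'] [Module ℝ E'] {F : E × E' → ℝ≥0∞} (hF : ELogConcave F) (x : E) :
    ELogConcave fun v => F (x, v) := by
  intro v w a b ha hb hab
  have := hF (x, v) (x, w) a b ha hb hab
  simpa [← add_smul, hab] using this

theorem ELogConcave.lintegral_real {E : Type*} [AddCommGroup E] [Module ℝ E]
    {F : E × ℝ → ℝ≥0∞} (hF : ELogConcave F) : ELogConcave fun x => ∫⁻ t, F (x, t) := by
  intro x y a b ha hb hab
  exact prekopa_leindler ha hb hab (hF.comp_prodMk x).measurable (hF.comp_prodMk y).measurable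
    (hF.comp_prodMk _).measurable fun s t => hF (x, s) (y, t) a b ha hb hab

/-- The linear map gluing a first coordinate onto a vector, in the form `(x, v), t ↦ (x, (t, v))`. -/
def prodConsLinearMap (E : Type*) [AddCommGroup E] [Module ℝ E] (n : ℕ) :
    ((E × (Fin n → ℝ)) × ℝ) →ₗ[ℝ] E × (Fin (n + 1) → ℝ) where
  toFun p := (p.1.1, Fin.insertNth 0 p.2 p.1.2)
  map_add' p q := by
    ext i
    · rfl
    · refine Fin.cases ?_ (fun j => ?_) i <;> simp
  map_smul' c p := by
    ext i
    · rfl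
    · refine Fin.cases ?_ (fun j => ?_) i <;> simp

/-- Marginals of log-concave functions are log-concave. -/
theorem ELogConcave.lintegral_pi {n : ℕ} : ∀ {E : Type*} [AddCommGroup E] [Module ℝ E]
    {F : E × (Fin n → ℝ) → ℝ≥0∞}, ELogConcave F → ELogConcave fun x => ∫⁻ v, F (x, v) := by
  induction n with
  | zero =>
    intro E _ _ F hF x y a b ha hb hab
    have hv : (volume : Measure (Fin 0 → ℝ)) = Measure.dirac default := by
      rw [volume_pi, Measure.pi_of_empty _ default]
    simp only [hv, lintegral_dirac]
    exact (hF (x, default) (y, default) a b ha hb hab).trans_eq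
      (congrArg F (Prod.ext rfl (Subsingleton.elim _ _)))
  | succ n ih =>
    intro E _ _ F hF
    have h := ih (hF.comp_linearMap (prodConsLinearMap E n)).lintegral_real
    convert h using 2 with x
    have e := (volume_preserving_piFinSuccAbove (fun _ : Fin (n + 1) => ℝ) 0).symm
    rw [← e.lintegral_comp_emb (MeasurableEquiv.measurableEmbedding _)]
    exact lintegral_prod_symm _ (((hF.comp_prodMk x).aemeasurable volume)
      |>.comp_quasiMeasurePreserving e.quasiMeasurePreserving)

/-- Tails of one-dimensional marginals of log-concave measures are log-concave. -/
theorem IsLogConcave.measure_halfSpace {n : ℕ} {μ : Measure (EucSp n)} (hμ : IsLogConcave μ)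
    (θ : EucSp n) : ELogConcave fun s : ℝ => μ {x | s ≤ ⟪x, θ⟫} := by
  obtain ⟨f, ⟨hf0, hf⟩, rfl⟩ := hμ
  have hF : ELogConcave fun p : ℝ × (Fin n → ℝ) =>
      {x : EucSp n | p.1 ≤ ⟪x, θ⟫}.indicator (fun x => ENNReal.ofReal (f x))
        (WithLp.toLp 2 p.2) := by
    rintro ⟨s, v⟩ ⟨t, w⟩ a b ha hb hab
    by_cases hs : s ≤ ⟪WithLp.toLp 2 v, θ⟫
    swap
    · simp [hs, ha]
    by_cases ht : t ≤ ⟪WithLp.toLp 2 w, θ⟫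
    swap
    · simp [ht, hb]
    have hst : a * s + b * t ≤ ⟪WithLp.toLp 2 (a • v + b • w), θ⟫ := by
      rw [WithLp.toLp_add, WithLp.toLp_smul, WithLp.toLp_smul, inner_add_left,
        real_inner_smul_left, real_inner_smul_left]
      gcongr
    beta_reduce
    rw [Set.indicator_of_mem (by exact hs), Set.indicator_of_mem (by exact ht),
      Set.indicator_of_mem (by exact hst), ENNReal.ofReal_rpow_of_nonneg (hf0 _) ha.le,
      ENNReal.ofReal_rpow_of_nonneg (hf0 _) hb.le,
      ← ENNReal.ofReal_mul (Real.rpow_nonneg (hf0 _) _)]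
    refine ENNReal.ofReal_le_ofReal ?_
    have := hf (WithLp.toLp 2 v) (WithLp.toLp 2 w) b ⟨hb.le, by linarith⟩
    rwa [show 1 - b = a by linarith] at this
  convert hF.lintegral_pi using 2 with s
  have hm : MeasurableSet {x : EucSp n | s ≤ ⟪x, θ⟫} :=
    measurableSet_le measurable_const (by fun_prop)
  rw [withDensity_apply _ hm, ← lintegral_indicator hm]
  exact ((PiLp.volume_preserving_toLp (Fin n)).lintegral_comp_emb
    (MeasurableEquiv.toLp 2 (Fin n → ℝ)).measurableEmbedding _).symm

theorem ELogConcave.mul_le_sq {G : ℝ → ℝ≥0∞} (hG : ELogConcave G) (s t : ℝ) :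
    G s * G t ≤ G ((s + t) / 2) ^ 2 := by
  have h := hG s t (1 / 2) (1 / 2) (by norm_num) (by norm_num) (by norm_num)
  have h2 := pow_le_pow_left₀ zero_le h 2
  have hsq : ∀ z : ℝ≥0∞, (z ^ (1 / 2 : ℝ)) ^ 2 = z := fun z => by
    rw [← ENNReal.rpow_natCast, ← ENNReal.rpow_mul]
    norm_num
  rw [mul_pow, hsq, hsq] at h2
  rwa [show (1 / 2 : ℝ) • s + (1 / 2 : ℝ) • t = (s + t) / 2 by
    rw [smul_eq_mul, smul_eq_mul]; ring] at h2

/-- A decreasing log-concave function that drops by a factor `3` once keeps doing so. -/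
theorem ELogConcave.le_inv_three_pow {G : ℝ → ℝ≥0∞} (hG : ELogConcave G) (hanti : Antitone G)
    (h1 : ∀ s, G s ≤ 1) (h3 : 3 * G 2 ≤ G (-2)) (k : ℕ) : G (4 * k - 2) ≤ (3⁻¹ : ℝ≥0∞) ^ k := by
  have hfin : ∀ s, G s ≠ ∞ := fun s => ne_top_of_le_ne_top ENNReal.one_ne_top (h1 s)
  have step : ∀ k : ℕ, 3 * G (4 * (k + 1 : ℕ) - 2) ≤ G (4 * k - 2) := by
    intro k
    induction k with
    | zero => norm_num; exact h3
    | succ k ih =>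
      by_cases h0 : G (4 * k - 2) = 0
      · have : G (4 * (k + 1 + 1 : ℕ) - 2) ≤ G (4 * k - 2) := hanti (by push_cast; linarith)
        rw [h0, nonpos_iff_eq_zero] at this
        rw [this, mul_zero]
        exact zero_le
      · have h := hG.mul_le_sq (4 * k - 2) (4 * (k + 1 + 1 : ℕ) - 2)
        rw [show ((4 * k - 2 : ℝ) + (4 * (k + 1 + 1 : ℕ) - 2)) / 2 = 4 * (k + 1 : ℕ) - 2 by
          push_cast; ring] at h
        refine (ENNReal.mul_le_mul_iff_right h0 (hfin _)).1 ?_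
        calc G (4 * k - 2) * (3 * G (4 * (k + 1 + 1 : ℕ) - 2))
            = 3 * (G (4 * k - 2) * G (4 * (k + 1 + 1 : ℕ) - 2)) := by ring
          _ ≤ 3 * G (4 * (k + 1 : ℕ) - 2) ^ 2 := by gcongr
          _ = (3 * G (4 * (k + 1 : ℕ) - 2)) * G (4 * (k + 1 : ℕ) - 2) := by ring
          _ ≤ G (4 * k - 2) * G (4 * (k + 1 : ℕ) - 2) := by gcongr
  induction k with
  | zero => simpa using h1 _
  | succ k ih =>
    rw [pow_succ']
    calc G (4 * (k + 1 : ℕ) - 2) = 3⁻¹ * (3 * G (4 * (k + 1 : ℕ) - 2)) := by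
          rw [← mul_assoc, ENNReal.inv_mul_cancel (by norm_num) (by norm_num), one_mul]
      _ ≤ 3⁻¹ * G (4 * k - 2) := by gcongr; exact step k
      _ ≤ 3⁻¹ * 3⁻¹ ^ k := by gcongr

/-- A bound for the fourth moment of normalized one-dimensional marginals. -/
def fourthMomentBound : ℝ≥0∞ :=
  ∑' k : ℕ, ENNReal.ofReal ((4 * k + 2) ^ 4) * (3⁻¹ ^ k + 3⁻¹ ^ k)

theorem fourthMomentBound_ne_top : fourthMomentBound ≠ ∞ := by
  have hs : Summable fun k : ℕ => ((4 * k + 2 : ℝ) ^ 4) * ((1 / 3) ^ k + (1 / 3) ^ k) := by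
    have h : ∀ j : ℕ, Summable fun k : ℕ => (k : ℝ) ^ j * (1 / 3) ^ k := fun j =>
      summable_pow_mul_geometric_of_norm_lt_one j (by norm_num)
    refine ((((((h 4).mul_left 512).add ((h 3).mul_left 1024)).add ((h 2).mul_left 768)).add
      ((h 1).mul_left 256)).add ((h 0).mul_left 32)).congr fun k => ?_
    ring
  have := hs.tsum_ofReal_ne_top
  convert this using 1
  refine tsum_congr fun k => ?_
  have h3 : ENNReal.ofReal ((1 / 3) ^ k) = 3⁻¹ ^ k := by
    rw [ENNReal.ofReal_pow (by norm_num), one_div, ENNReal.ofReal_inv_of_pos (by norm_num)]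
    norm_num
  rw [ENNReal.ofReal_mul (by positivity), ENNReal.ofReal_add (by positivity) (by positivity), h3]

theorem pow_four_le_tsum (r : ℝ) : ENNReal.ofReal (r ^ 4) ≤
    ∑' k : ℕ, ENNReal.ofReal ((4 * k + 2) ^ 4) *
      ((Set.Ici (4 * k - 2 : ℝ)).indicator 1 r + (Set.Ici (4 * k - 2 : ℝ)).indicator 1 (-r)) := by
  set k := ⌊(|r| + 2) / 4⌋₊
  have hk1 : (k : ℝ) ≤ (|r| + 2) / 4 := Nat.floor_le (by positivity)
  have hk2 : (|r| + 2) / 4 < k + 1 := Nat.lt_floor_add_one _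
  refine le_trans ?_ (ENNReal.le_tsum k)
  have hr : r ^ 4 ≤ (4 * k + 2) ^ 4 := by
    rw [← Even.pow_abs (by decide : Even 4) r]
    gcongr
    linarith
  refine (ENNReal.ofReal_le_ofReal hr).trans (le_mul_of_one_le_right zero_le ?_)
  rcases abs_choice r with h | h
  · refine le_add_of_le_of_nonneg ?_ zero_le
    rw [Set.indicator_of_mem (by rw [Set.mem_Ici]; linarith)]
    simp
  · refine le_add_of_nonneg_of_le zero_le ?_
    rw [Set.indicator_of_mem (by rw [Set.mem_Ici]; linarith)]
    simp

theorem IsIsotropic.integrable_inner_mul_inner {n : ℕ} {μ : Measure (EucSp n)}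
    (hμ : IsIsotropic μ) (u : EucSp n) : Integrable (fun x => ⟪x, u⟫ * ⟪x, u⟫) μ := by
  by_cases hu : u = 0
  · simp [hu]
  · refine not_imp_comm.1 integral_undef ?_
    rw [hμ.2 u u]
    simpa using hu

theorem IsIsotropic.lintegral_sq {n : ℕ} {μ : Measure (EucSp n)}
    (hμ : IsIsotropic μ) {θ : EucSp n} (hθ : ‖θ‖ = 1) :
    ∫⁻ x, ENNReal.ofReal (⟪x, θ⟫ ^ 2) ∂μ = 1 := by
  have hi := hμ.integrable_inner_mul_inner θ
  have h2 := hμ.2 θ θ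
  simp only [← pow_two] at hi h2
  rw [← ofReal_integral_eq_lintegral_ofReal hi (ae_of_all _ fun x => sq_nonneg _), h2]
  simp [hθ]

theorem IsIsotropic.measure_two_le {n : ℕ} {μ : Measure (EucSp n)} [IsProbabilityMeasure μ]
    (hμ : IsIsotropic μ) {θ : EucSp n} (hθ : ‖θ‖ = 1) :
    μ {x | 2 ≤ |⟪x, θ⟫|} ≤ 4⁻¹ := by
  have h := mul_meas_ge_le_lintegral₀ (μ := μ) (f := fun x => ENNReal.ofReal (⟪x, θ⟫ ^ 2))
    (by fun_prop) 4
  rw [hμ.lintegral_sq hθ, mul_comm, ← ENNReal.le_div_iff_mul_le (by simp) (by simp), one_div] at h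
  refine (measure_mono fun x hx => ?_).trans h
  rw [Set.mem_ofPred_eq] at hx ⊢
  rw [show (4 : ℝ≥0∞) = ENNReal.ofReal 4 by norm_num]
  refine ENNReal.ofReal_le_ofReal ?_
  rw [← sq_abs]
  nlinarith

theorem tail_le {n : ℕ} {μ : Measure (EucSp n)} [IsProbabilityMeasure μ]
    (hμ : IsIsotropic μ) (hμ' : IsLogConcave μ) {θ : EucSp n} (hθ : ‖θ‖ = 1) (k : ℕ) :
    μ {x | (4 * k - 2 : ℝ) ≤ ⟪x, θ⟫} ≤ 3⁻¹ ^ k := by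
  refine (hμ'.measure_halfSpace θ).le_inv_three_pow
    (fun s t hst => measure_mono fun x hx => hst.trans hx) (fun s => prob_le_one) ?_ k
  have h2 : μ {x | 2 ≤ ⟪x, θ⟫} ≤ 4⁻¹ :=
    (measure_mono fun x (hx : 2 ≤ ⟪x, θ⟫) => hx.trans (le_abs_self _)).trans (hμ.measure_two_le hθ)
  have h2' : 3 * 4⁻¹ ≤ μ {x | -2 ≤ ⟪x, θ⟫} := by
    have hm : MeasurableSet {x : EucSp n | -2 ≤ ⟪x, θ⟫} :=
      measurableSet_le measurable_const (by fun_prop)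
    have hc : μ {x | -2 ≤ ⟪x, θ⟫}ᶜ ≤ 4⁻¹ := by
      refine (measure_mono fun x hx => ?_).trans (hμ.measure_two_le hθ)
      simp only [Set.mem_compl_iff, Set.mem_ofPred_eq, not_le] at hx ⊢
      rw [abs_of_neg (by linarith)]
      linarith
    have hone : μ {x | -2 ≤ ⟪x, θ⟫} + 4⁻¹ ≥ 1 := by
      rw [← prob_add_prob_compl (μ := μ) hm]
      gcongr
    have h4 : (1 : ℝ≥0∞) = 3 * 4⁻¹ + 4⁻¹ := by
      rw [← add_one_mul, show (3 + 1 : ℝ≥0∞) = 4 by norm_num,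
        ENNReal.mul_inv_cancel (by norm_num) (by norm_num)]
    rw [h4] at hone
    exact (ENNReal.add_le_add_iff_right (by simp)).1 hone
  exact le_trans (by gcongr) h2'

theorem lintegral_pow_four_le {n : ℕ} {μ : Measure (EucSp n)} [IsProbabilityMeasure μ]
    (hμ : IsIsotropic μ) (hμ' : IsLogConcave μ) {θ : EucSp n} (hθ : ‖θ‖ = 1) :
    ∫⁻ x, ENNReal.ofReal (⟪x, θ⟫ ^ 4) ∂μ ≤ fourthMomentBound := by
  have hmeas : ∀ (k : ℕ) (v : EucSp n),
      MeasurableSet {x : EucSp n | (4 * k - 2 : ℝ) ≤ ⟪x, v⟫} := fun k v =>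
    measurableSet_le measurable_const (by fun_prop)
  have hind : ∀ (k : ℕ) (v x : EucSp n), (Set.Ici (4 * k - 2 : ℝ)).indicator (1 : ℝ → ℝ≥0∞) ⟪x, v⟫
      = {x : EucSp n | (4 * k - 2 : ℝ) ≤ ⟪x, v⟫}.indicator 1 x := fun k v x => rfl
  have hm : ∀ (k : ℕ) (v : EucSp n), Measurable fun x : EucSp n =>
      (Set.Ici (4 * k - 2 : ℝ)).indicator (1 : ℝ → ℝ≥0∞) ⟪x, v⟫ := fun k v => by
    simp only [hind]
    exact measurable_one.indicator (hmeas k v)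
  refine (lintegral_mono fun x => pow_four_le_tsum _).trans ?_
  simp only [← inner_neg_right]
  have hm2 : ∀ k : ℕ, Measurable fun x : EucSp n =>
      (Set.Ici (4 * k - 2 : ℝ)).indicator (1 : ℝ → ℝ≥0∞) ⟪x, θ⟫
        + (Set.Ici (4 * k - 2 : ℝ)).indicator (1 : ℝ → ℝ≥0∞) ⟪x, -θ⟫ :=
    fun k => (hm k θ).add (hm k (-θ))
  rw [lintegral_tsum fun k => ((hm2 k).const_mul _).aemeasurable]
  refine ENNReal.tsum_le_tsum fun k => ?_
  rw [lintegral_const_mul _ (hm2 k), lintegral_add_left (hm k θ)]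
  simp only [hind]
  rw [lintegral_indicator_one (hmeas _ _), lintegral_indicator_one (hmeas _ _)]
  gcongr
  · exact tail_le hμ hμ' hθ k
  · exact tail_le hμ hμ' (by rwa [norm_neg]) k

theorem integrable_pow_four {n : ℕ} {μ : Measure (EucSp n)} [IsProbabilityMeasure μ]
    (hμ : IsIsotropic μ) (hμ' : IsLogConcave μ) {θ : EucSp n} (hθ : ‖θ‖ = 1) :
    Integrable (fun x => ⟪x, θ⟫ ^ 4) μ :=
  (lintegral_ofReal_ne_top_iff_integrable (by fun_prop) (ae_of_all _ fun x => by positivity)).1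
    (ne_top_of_le_ne_top fourthMomentBound_ne_top (lintegral_pow_four_le hμ hμ' hθ))

theorem integral_pow_four_le {n : ℕ} {μ : Measure (EucSp n)} [IsProbabilityMeasure μ]
    (hμ : IsIsotropic μ) (hμ' : IsLogConcave μ) {θ : EucSp n} (hθ : ‖θ‖ = 1) :
    ∫ x, ⟪x, θ⟫ ^ 4 ∂μ ≤ fourthMomentBound.toReal := by
  rw [integral_eq_lintegral_of_nonneg_ae (ae_of_all _ fun x => by positivity) (by fun_prop)]
  exact ENNReal.toReal_mono fourthMomentBound_ne_top (lintegral_pow_four_le hμ hμ' hθ)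

theorem norm_sq_eq_sum_inner_single {n : ℕ} (x : EucSp n) :
    ‖x‖ ^ 2 = ∑ i, ⟪x, EuclideanSpace.single i (1 : ℝ)⟫ ^ 2 := by
  simp [EuclideanSpace.norm_sq_eq, EuclideanSpace.inner_single_right]

theorem IsIsotropic.integrable_norm_sq {n : ℕ} {μ : Measure (EucSp n)} (hμ : IsIsotropic μ) :
    Integrable (fun x => ‖x‖ ^ 2) μ := by
  simp only [norm_sq_eq_sum_inner_single]
  simp only [pow_two]
  exact integrable_finsetSum _ fun i _ => hμ.integrable_inner_mul_inner _

theorem IsIsotropic.integral_norm_sq {n : ℕ} {μ : Measure (EucSp n)} (hμ : IsIsotropic μ) :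
    ∫ x, ‖x‖ ^ 2 ∂μ = n := by
  simp only [norm_sq_eq_sum_inner_single]
  simp only [pow_two]
  rw [integral_finsetSum _ fun i _ => hμ.integrable_inner_mul_inner _]
  simp [hμ.2]

theorem IsIsotropic.integrable_norm {n : ℕ} {μ : Measure (EucSp n)} [IsProbabilityMeasure μ]
    (hμ : IsIsotropic μ) : Integrable (fun x => ‖x‖) μ :=
  ((integrable_const (1 : ℝ)).add hμ.integrable_norm_sq).mono' (by fun_prop)
    (ae_of_all _ fun x => by
      simp only [norm_norm, Pi.add_apply]
      nlinarith [sq_nonneg (‖x‖ - 1)])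

theorem IsIsotropic.integrable_norm_sub_sq {n : ℕ} {μ : Measure (EucSp n)} [IsProbabilityMeasure μ]
    (hμ : IsIsotropic μ) : Integrable (fun x => (‖x‖ - √n) ^ 2) μ := by
  simp only [sub_sq]
  exact (hμ.integrable_norm_sq.sub ((hμ.integrable_norm.const_mul 2).mul_const _)).add
    (integrable_const _)

theorem IsIsotropic.integral_norm_sub_sq_le {n : ℕ} {μ : Measure (EucSp n)}
    [IsProbabilityMeasure μ] (hμ : IsIsotropic μ) : ∫ x, (‖x‖ - √n) ^ 2 ∂μ ≤ 2 * n := by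
  calc ∫ x, (‖x‖ - √n) ^ 2 ∂μ ≤ ∫ x, (‖x‖ ^ 2 + n) ∂μ := by
        refine integral_mono hμ.integrable_norm_sub_sq
          (hμ.integrable_norm_sq.add (integrable_const _)) fun x => ?_
        have := mul_nonneg (norm_nonneg x) (Real.sqrt_nonneg n)
        nlinarith [Real.sq_sqrt (Nat.cast_nonneg (α := ℝ) n)]
    _ = 2 * n := by
        rw [integral_add hμ.integrable_norm_sq (integrable_const _), hμ.integral_norm_sq]
        simp
        ring

theorem integral_mul_sq_le {α : Type*} [MeasurableSpace α] {μ : Measure α} {u v : α → ℝ}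
    (hu : Integrable (fun x => u x ^ 2) μ) (hv : Integrable (fun x => v x ^ 2) μ)
    (huv : Integrable (fun x => u x * v x) μ) :
    (∫ x, u x * v x ∂μ) ^ 2 ≤ (∫ x, u x ^ 2 ∂μ) * ∫ x, v x ^ 2 ∂μ := by
  have h := discrim_le_zero (a := ∫ x, u x ^ 2 ∂μ) (b := 2 * ∫ x, u x * v x ∂μ)
    (c := ∫ x, v x ^ 2 ∂μ) fun t => by
      have hnn : 0 ≤ ∫ x, (t * t * u x ^ 2 + 2 * t * (u x * v x) + v x ^ 2) ∂μ :=
        integral_nonneg fun x => by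
          change 0 ≤ t * t * u x ^ 2 + 2 * t * (u x * v x) + v x ^ 2
          nlinarith [sq_nonneg (t * u x + v x)]
      rw [integral_add (f := fun x => t * t * u x ^ 2 + 2 * t * (u x * v x))
          ((hu.const_mul _).add (huv.const_mul _)) hv,
        integral_add (hu.const_mul _) (huv.const_mul _), integral_const_mul,
        integral_const_mul] at hnn
      linarith
  rw [discrim] at h
  linarith

theorem norm_add_mul_inner_sq_le {n : ℕ} (x θ : EucSp n) :
    ((‖x‖ + √n) * ⟪x, θ⟫) ^ 2 ≤
      (∑ i, (⟪x, EuclideanSpace.single i (1 : ℝ)⟫ ^ 4 + ⟪x, θ⟫ ^ 4)) +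
        2 * n * (⟪x, θ⟫ * ⟪x, θ⟫) := by
  have h1 : (‖x‖ + √n) ^ 2 ≤ 2 * ‖x‖ ^ 2 + 2 * n := by
    nlinarith [Real.sq_sqrt (Nat.cast_nonneg (α := ℝ) n), sq_nonneg (‖x‖ - √n)]
  have h2 : 2 * ‖x‖ ^ 2 * ⟪x, θ⟫ ^ 2 ≤
      ∑ i, (⟪x, EuclideanSpace.single i (1 : ℝ)⟫ ^ 4 + ⟪x, θ⟫ ^ 4) := by
    rw [norm_sq_eq_sum_inner_single, Finset.mul_sum, Finset.sum_mul]
    refine Finset.sum_le_sum fun i _ => ?_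
    nlinarith [sq_nonneg (⟪x, EuclideanSpace.single i (1 : ℝ)⟫ ^ 2 - ⟪x, θ⟫ ^ 2)]
  rw [mul_pow]
  nlinarith [mul_le_mul_of_nonneg_right h1 (sq_nonneg ⟪x, θ⟫)]

theorem integrable_norm_add_mul_inner_sq {n : ℕ} {μ : Measure (EucSp n)} [IsProbabilityMeasure μ]
    (hμ : IsIsotropic μ) (hμ' : IsLogConcave μ) {θ : EucSp n} (hθ : ‖θ‖ = 1) :
    Integrable (fun x => ((‖x‖ + √n) * ⟪x, θ⟫) ^ 2) μ ∧
      ∫ x, ((‖x‖ + √n) * ⟪x, θ⟫) ^ 2 ∂μ ≤ (2 * fourthMomentBound.toReal + 2) * n := by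
  have he : ∀ i : Fin n, ‖EuclideanSpace.single i (1 : ℝ)‖ = 1 := fun i => by simp
  have hi : ∀ i : Fin n, Integrable
      (fun x : EucSp n => ⟪x, EuclideanSpace.single i (1 : ℝ)⟫ ^ 4 + ⟪x, θ⟫ ^ 4) μ := fun i =>
    (integrable_pow_four hμ hμ' (he i)).add (integrable_pow_four hμ hμ' hθ)
  have h1 := integrable_finsetSum Finset.univ fun i _ => hi i
  have h2 := (hμ.integrable_inner_mul_inner θ).const_mul (2 * n : ℝ)
  have hsq_int : Integrable (fun x => ((‖x‖ + √n) * ⟪x, θ⟫) ^ 2) μ :=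
    (h1.add h2).mono' (by fun_prop) (ae_of_all _ fun x => by
      rw [Real.norm_of_nonneg (sq_nonneg _)]
      exact norm_add_mul_inner_sq_le x θ)
  refine ⟨hsq_int, (integral_mono hsq_int (h1.add h2) (norm_add_mul_inner_sq_le · θ)).trans ?_⟩
  rw [integral_add' h1 h2, integral_const_mul, hμ.2, integral_finsetSum _ fun i _ => hi i]
  have h4 : ∀ i : Fin n,
      ∫ x, (⟪x, EuclideanSpace.single i (1 : ℝ)⟫ ^ 4 + ⟪x, θ⟫ ^ 4) ∂μ ≤
        2 * fourthMomentBound.toReal := fun i => by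
    rw [integral_add (integrable_pow_four hμ hμ' (he i)) (integrable_pow_four hμ hμ' hθ)]
    linarith [integral_pow_four_le hμ hμ' (he i), integral_pow_four_le hμ hμ' hθ]
  have h5 := Finset.sum_le_sum fun i (_ : i ∈ Finset.univ) => h4 i
  rw [Finset.sum_const, Finset.card_univ, Fintype.card_fin, nsmul_eq_mul] at h5
  rw [real_inner_self_eq_norm_sq, hθ]
  linarith

theorem norm_integral_norm_sq_smul_sq_le {n : ℕ} {μ : Measure (EucSp n)} [IsProbabilityMeasure μ]
    (hμ : IsIsotropic μ) (hμ' : IsLogConcave μ) :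
    ‖∫ x, (‖x‖ ^ 2) • x ∂μ‖ ^ 2 ≤
      (2 * fourthMomentBound.toReal + 2) * n * ∫ x, (‖x‖ - √n) ^ 2 ∂μ := by
  set M := ∫ x, (‖x‖ ^ 2) • x ∂μ
  have hA : 0 ≤ ∫ x, (‖x‖ - √n) ^ 2 ∂μ := integral_nonneg fun x => sq_nonneg _
  rcases eq_or_ne M 0 with h0 | h0
  · rw [h0]
    simp only [norm_zero, ne_eq, OfNat.ofNat_ne_zero, not_false_eq_true, zero_pow]
    positivity
  have hMi : Integrable (fun x : EucSp n => (‖x‖ ^ 2) • x) μ := by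
    by_contra h
    exact h0 (integral_undef h)
  have hxi : Integrable (fun x : EucSp n => x) μ :=
    hμ.integrable_norm.mono' (by fun_prop) (ae_of_all _ fun x => le_rfl)
  set θ : EucSp n := ‖M‖⁻¹ • M with hθdef
  have hθ : ‖θ‖ = 1 := norm_smul_inv_norm (𝕜 := ℝ) h0
  obtain ⟨hv, hvle⟩ := integrable_norm_add_mul_inner_sq hμ hμ' hθ
  have hu := hμ.integrable_norm_sub_sq
  have huv : Integrable (fun x => (‖x‖ - √n) * ((‖x‖ + √n) * ⟪x, θ⟫)) μ :=
    (hu.add hv).mono' (by fun_prop) (ae_of_all _ fun x => by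
      rw [Real.norm_eq_abs, abs_le]
      simp only [Pi.add_apply]
      constructor <;>
        nlinarith [sq_nonneg ((‖x‖ - √n) + ((‖x‖ + √n) * ⟪x, θ⟫)),
          sq_nonneg ((‖x‖ - √n) - ((‖x‖ + √n) * ⟪x, θ⟫))])
  have hMθ : ‖M‖ = ∫ x, (‖x‖ - √n) * ((‖x‖ + √n) * ⟪x, θ⟫) ∂μ := by
    have hinner : ⟪θ, M⟫ = ‖M‖ := by
      rw [hθdef, real_inner_smul_left, real_inner_self_eq_norm_sq]
      field_simp
    calc ‖M‖ = ⟪θ, M⟫ - n * ⟪θ, ∫ x, x ∂μ⟫ := by rw [hinner, hμ.1, inner_zero_right]; ring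
      _ = ∫ x, (⟪θ, (‖x‖ ^ 2) • x⟫ - n * ⟪θ, x⟫) ∂μ := by
        rw [integral_sub (hMi.const_inner θ) ((hxi.const_inner θ).const_mul _),
          integral_const_mul, integral_inner hMi, integral_inner hxi]
      _ = _ := by
        refine integral_congr_ae (ae_of_all _ fun x => ?_)
        simp only [real_inner_smul_right, real_inner_comm x θ]
        linear_combination ⟪x, θ⟫ * Real.sq_sqrt (Nat.cast_nonneg (α := ℝ) n)
  rw [hMθ]
  refine (integral_mul_sq_le hu hv huv).trans ?_
  rw [mul_comm]
  gcongr

/-- There exists a universal constant C > 0 such that for any n ≥ 1, σ̲_n ≤ C σ_n. -/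
theorem sigmaBar_le_sigmaN :
    ∃ C : ℝ, 0 < C ∧ ∀ n : ℕ, 1 ≤ n → sigmaBar n ≤ C * sigmaN n := by
  have hK : 0 < 2 * fourthMomentBound.toReal + 2 := by positivity
  refine ⟨√(2 * fourthMomentBound.toReal + 2), Real.sqrt_pos.2 hK, fun n hn => ?_⟩
  have hn' : 0 < √(n : ℝ) := Real.sqrt_pos.2 (by exact_mod_cast hn)
  rw [sigmaBar, inv_mul_le_iff₀ hn']
  refine Real.sSup_le ?_ (by unfold sigmaN; positivity)
  rintro _ ⟨μ, hμp, hμ, hμ', rfl⟩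
  have hle : ∫ x, (‖x‖ - √n) ^ 2 ∂μ ≤ sigmaNSq n := by
    refine le_csSup ⟨2 * n, ?_⟩ ⟨μ, hμp, hμ, hμ', rfl⟩
    rintro _ ⟨ν, hνp, hν, -, rfl⟩
    exact hν.integral_norm_sub_sq_le
  rw [sigmaN, ← mul_assoc, mul_comm (√(n : ℝ)), ← Real.sqrt_mul hK.le,
    ← Real.sqrt_mul (by positivity)]
  refine Real.le_sqrt_of_sq_le ((norm_integral_norm_sq_smul_sq_le hμ hμ').trans ?_)
  gcongr
end
end

section
/- Let μ be a compactly-supported Borel probability measure on ℝⁿ whose support is not contained in a hyperplane, and let K ⊂ ℝⁿ be the interior of the convex hull of the support of μ. Then the image of the gradient map of the logarithmic Laplace transform equals K, i.e., ∇Λ_μ(ℝⁿ) = { ∇Λ_μ(ξ) : ξ ∈ ℝⁿ } = K. -/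
open MeasureTheory Real Set Filter Topology RealInnerProductSpace
noncomputable section

/-- The support of a Borel measure: the minimal closed set of full measure,
i.e. the set of points all of whose neighborhoods have positive measure. -/
def msupport {n : ℕ} (μ : Measure (EucSp n)) : Set (EucSp n) :=
  {x | ∀ U ∈ nhds x, μ U ≠ 0}

/-- μ is compactly supported. -/
def IsCompactlySupported {n : ℕ} (μ : Measure (EucSp n)) : Prop :=
  ∃ K : Set (EucSp n), IsCompact K ∧ μ Kᶜ = 0

/-- The support of μ is not contained in a hyperplane (an affine hyperplane). -/
def SuppNotInHyperplane {n : ℕ} (μ : Measure (EucSp n)) : Prop :=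
  ¬ ∃ (θ : EucSp n) (c : ℝ), θ ≠ 0 ∧ msupport μ ⊆ {x | ⟪θ, x⟫ = c}

/-- The logarithmic Laplace transform Λ_μ(ξ) = log ∫ exp(ξ·x) dμ(x). -/
def logLaplace {n : ℕ} (μ : Measure (EucSp n)) (ξ : EucSp n) : ℝ :=
  Real.log (∫ x, Real.exp ⟪ξ, x⟫ ∂μ)

/-- The Hessian matrix of a function f : ℝⁿ → ℝ at a point ξ. -/
def hessianM {n : ℕ} (f : EucSp n → ℝ) (ξ : EucSp n) : Matrix (Fin n) (Fin n) ℝ :=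
  Matrix.of fun i j =>
    fderiv ℝ (fun η => fderiv ℝ f η (EuclideanSpace.single j 1)) ξ
      (EuclideanSpace.single i 1)

/-- Ψ_μ(ξ) = log ( det ∇²Λ_μ(ξ) / det ∇²Λ_μ(0) ). -/
def PsiFn {n : ℕ} (μ : Measure (EucSp n)) (ξ : EucSp n) : ℝ :=
  Real.log ((hessianM (logLaplace μ) ξ).det / (hessianM (logLaplace μ) 0).det)

section Geometry

variable {E : Type*} [NormedAddCommGroup E] [InnerProductSpace ℝ E]

lemma exists_inner_pos_of_mem_interior_convexHull {S : Set E} {y : E}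
    (hy : y ∈ interior (convexHull ℝ S)) {θ : E} (hθ : θ ≠ 0) : ∃ x ∈ S, 0 < ⟪θ, x - y⟫ := by
  by_contra! h
  have hsub : convexHull ℝ S ⊆ {x | ⟪θ, x⟫ ≤ ⟪θ, y⟫} :=
    convexHull_min (fun x hx => by simpa [inner_sub_right] using h x hx)
      (convex_halfSpace_le (innerSL ℝ θ).toLinearMap.isLinear _)
  have hlim : Tendsto (fun t : ℝ => y + t • θ) (𝓝[>] 0) (𝓝 y) :=
    tendsto_nhdsWithin_of_tendsto_nhds
      ((by fun_prop : Continuous fun t : ℝ => y + t • θ).tendsto' 0 y (by simp))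
  obtain ⟨t, ht, htpos⟩ :=
    ((hlim.eventually_mem (mem_interior_iff_mem_nhds.1 hy)).and self_mem_nhdsWithin).exists
  have := hsub ht
  rw [mem_ofPred_eq, inner_add_right, real_inner_smul_right] at this
  nlinarith [mul_pos htpos (real_inner_self_pos.2 hθ)]

lemma affineSpan_eq_top_of_not_subset_hyperplane [FiniteDimensional ℝ E] {S : Set E}
    (hne : S.Nonempty)
    (hS : ∀ (θ : E) (c : ℝ), S ⊆ {x | ⟪θ, x⟫ = c} → θ = 0) : affineSpan ℝ S = ⊤ := by
  obtain ⟨x₀, hx₀⟩ := hne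
  have hmem := subset_affineSpan ℝ S hx₀
  rw [← AffineSubspace.direction_eq_top_iff_of_nonempty ⟨x₀, hmem⟩,
    ← Submodule.orthogonal_eq_bot_iff, Submodule.eq_bot_iff]
  intro θ hθ
  refine hS θ ⟪θ, x₀⟫ fun x hx => ?_
  have h := Submodule.inner_left_of_mem_orthogonal
    (AffineSubspace.vsub_mem_direction (subset_affineSpan ℝ S hx) hmem) hθ
  rw [vsub_eq_sub, inner_sub_right] at h
  exact sub_eq_zero.1 h

lemma exists_mul_norm_le_of_continuous_homogeneous [FiniteDimensional ℝ E] {g : E → ℝ}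
    (hg : Continuous g)
    (hpos : ∀ θ, θ ≠ 0 → 0 < g θ) (hhom : ∀ (t : ℝ) (θ : E), 0 ≤ t → g (t • θ) = t * g θ) :
    ∃ c > 0, ∀ θ, c * ‖θ‖ ≤ g θ := by
  have hg0 : g 0 = 0 := by simpa using hhom 0 0 le_rfl
  rcases subsingleton_or_nontrivial E with h | h
  · exact ⟨1, one_pos, fun θ => by simp [Subsingleton.elim θ 0, hg0]⟩
  obtain ⟨θ₀, hθ₀, hmin⟩ := (isCompact_sphere (0 : E) 1).exists_isMinOn
    (NormedSpace.sphere_nonempty.2 zero_le_one) hg.continuousOn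
  refine ⟨g θ₀, hpos _ (ne_zero_of_mem_unit_sphere ⟨θ₀, hθ₀⟩), fun θ => ?_⟩
  rcases eq_or_ne θ 0 with rfl | hθ
  · simp [hg0]
  have hn := norm_pos_iff.2 hθ
  have h := hmin (show ‖θ‖⁻¹ • θ ∈ Metric.sphere (0 : E) 1 by
    simp [norm_smul, inv_mul_cancel₀ hn.ne'])
  rw [mem_ofPred_eq, hhom _ _ (by positivity)] at h
  calc g θ₀ * ‖θ‖ ≤ ‖θ‖⁻¹ * g θ * ‖θ‖ := by gcongr
    _ = g θ := by field_simp

end Geometry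

section Laplace

variable {E : Type*} [NormedAddCommGroup E] [InnerProductSpace ℝ E] [FiniteDimensional ℝ E]
  [MeasurableSpace E] [BorelSpace E] {μ : Measure E} {K : Set E}

lemma Continuous.integrable_of_measure_compl_eq_zero [IsFiniteMeasure μ] {F : Type*}
    [NormedAddCommGroup F] [SecondCountableTopologyEither E F] {f : E → F}
    (hf : Continuous f) (hK : IsCompact K) (hμK : μ Kᶜ = 0) : Integrable f μ := by
  have h : IntegrableOn f K μ := hf.continuousOn.integrableOn_compact hK
  rwa [IntegrableOn, Measure.restrict_eq_self_of_ae_mem (by exact hμK)] at h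

lemma hasFDerivAt_integral_exp_inner [IsFiniteMeasure μ] (hK : IsCompact K) (hμK : μ Kᶜ = 0)
    (ξ : E) :
    HasFDerivAt (fun η : E => ∫ x, exp ⟪η, x⟫ ∂μ)
      (innerSL ℝ (∫ x, exp ⟪ξ, x⟫ • x ∂μ)) ξ := by
  obtain ⟨R, hR⟩ := hK.isBounded.exists_norm_le
  have hint : Integrable (fun x : E => exp ⟪ξ, x⟫ • x) μ :=
    Continuous.integrable_of_measure_compl_eq_zero (by fun_prop) hK hμK
  rw [← ContinuousLinearMap.integral_comp_comm _ hint]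
  refine hasFDerivAt_integral_of_dominated_of_fderiv_le (s := Metric.ball ξ 1)
    (F' := fun η x => innerSL ℝ (exp ⟪η, x⟫ • x))
    (bound := fun _ => exp ((‖ξ‖ + 1) * R) * R) (Metric.ball_mem_nhds ξ one_pos)
    (Eventually.of_forall fun η => Continuous.aestronglyMeasurable (by fun_prop))
    (Continuous.integrable_of_measure_compl_eq_zero (by fun_prop) hK hμK)
    (Continuous.aestronglyMeasurable (by fun_prop)) ?_ (integrable_const _) ?_
  · filter_upwards [show ∀ᵐ x ∂μ, x ∈ K from hμK] with x hx η hη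
    have hη' : ‖η‖ ≤ ‖ξ‖ + 1 := by
      have := norm_le_norm_add_norm_sub' η ξ
      rw [mem_ball_iff_norm] at hη
      linarith
    have hxR := hR x hx
    rw [innerSL_apply_norm, norm_smul, norm_of_nonneg (exp_pos _).le]
    gcongr
    exact (real_inner_le_norm η x).trans (by gcongr)
  · refine Eventually.of_forall fun x η _ => ?_
    have h : HasFDerivAt (fun η : E => ⟪η, x⟫) (innerSL ℝ x) η := by
      simpa [real_inner_comm] using (innerSL ℝ x).hasFDerivAt (x := η)
    simpa using h.exp

lemma integral_exp_inner_pos [IsProbabilityMeasure μ] (hK : IsCompact K) (hμK : μ Kᶜ = 0)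
    (ξ : E) : 0 < ∫ x, exp ⟪ξ, x⟫ ∂μ :=
  integral_exp_pos (Continuous.integrable_of_measure_compl_eq_zero (by fun_prop) hK hμK)

lemma hasGradientAt_log_integral_exp_inner [IsProbabilityMeasure μ] (hK : IsCompact K)
    (hμK : μ Kᶜ = 0) (ξ : E) :
    HasGradientAt (fun η : E => log (∫ x, exp ⟪η, x⟫ ∂μ))
      ((∫ x, exp ⟪ξ, x⟫ ∂μ)⁻¹ • ∫ x, exp ⟪ξ, x⟫ • x ∂μ) ξ := by
  rw [hasGradientAt_iff_hasFDerivAt, map_smul]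
  exact (hasFDerivAt_integral_exp_inner hK hμK ξ).log (integral_exp_inner_pos hK hμK ξ).ne'

lemma exp_barycenter_mem_interior_convexHull_support [IsProbabilityMeasure μ] (hK : IsCompact K)
    (hμK : μ Kᶜ = 0) (hS : ∀ (θ : E) (c : ℝ), μ.support ⊆ {x | ⟪θ, x⟫ = c} → θ = 0) (ξ : E) :
    ((∫ x, exp ⟪ξ, x⟫ ∂μ)⁻¹ • ∫ x, exp ⟪ξ, x⟫ • x ∂μ) ∈
      interior (convexHull ℝ μ.support) := by
  set b := (∫ x, exp ⟪ξ, x⟫ ∂μ)⁻¹ • ∫ x, exp ⟪ξ, x⟫ • x ∂μ with hb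
  by_contra hnot
  have hconv : Convex ℝ (convexHull ℝ μ.support) := convex_convexHull ℝ _
  have hne : (interior (convexHull ℝ μ.support)).Nonempty :=
    interior_convexHull_nonempty_iff_affineSpan_eq_top.2
      (affineSpan_eq_top_of_not_subset_hyperplane
        (Measure.nonempty_support (IsProbabilityMeasure.ne_zero μ)) hS)
  obtain ⟨f, hf⟩ := geometric_hahn_banach_open_point hconv.interior isOpen_interior hnot
  obtain ⟨θ, rfl⟩ := (InnerProductSpace.toDual ℝ E).surjective f
  simp only [InnerProductSpace.toDual_apply_apply] at hf
  have hle : ∀ x ∈ μ.support, ⟪θ, x⟫ ≤ ⟪θ, b⟫ := by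
    intro x hx
    have hx' : x ∈ closure (interior (convexHull ℝ μ.support)) := by
      rw [hconv.closure_interior_eq_closure_of_nonempty_interior hne]
      exact subset_closure (subset_convexHull ℝ _ hx)
    have hclosed : IsClosed {a | ⟪θ, a⟫ ≤ ⟪θ, b⟫} := isClosed_le (by fun_prop) continuous_const
    exact closure_minimal (fun a ha => (hf a ha).le) hclosed hx'
  have hint : ∀ {f : E → ℝ}, Continuous f → Integrable f μ := fun hf =>
    hf.integrable_of_measure_compl_eq_zero hK hμK
  have hzero : ∫ x, exp ⟪ξ, x⟫ * (⟪θ, b⟫ - ⟪θ, x⟫) ∂μ = 0 := by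
    have hinner : ∫ x, exp ⟪ξ, x⟫ * ⟪θ, x⟫ ∂μ = ⟪θ, ∫ x, exp ⟪ξ, x⟫ • x ∂μ⟫ := by
      have hvec : Integrable (fun x : E => exp ⟪ξ, x⟫ • x) μ :=
        Continuous.integrable_of_measure_compl_eq_zero (by fun_prop) hK hμK
      rw [← integral_inner hvec]
      simp only [real_inner_smul_right]
    simp only [mul_sub]
    rw [integral_sub (hint (by fun_prop)) (hint (by fun_prop)), integral_mul_const, hinner, hb,
      real_inner_smul_right, mul_inv_cancel_left₀ (integral_exp_inner_pos hK hμK ξ).ne', sub_self]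
  have hae := (integral_eq_zero_iff_of_nonneg_ae (by
    filter_upwards [Measure.support_mem_ae] with x hx
    exact mul_nonneg (exp_pos _).le (sub_nonneg.2 (hle x hx))) (hint (by fun_prop))).1 hzero
  have hθ : θ = 0 := by
    refine hS θ ⟪θ, b⟫ (Measure.support_subset_of_isClosed
      (isClosed_eq (by fun_prop) continuous_const) ?_)
    filter_upwards [hae] with x hx
    have := (mul_eq_zero.1 hx).resolve_left (exp_pos _).ne'
    exact (sub_eq_zero.1 this).symm
  obtain ⟨a, ha⟩ := hne
  simpa [hθ] using hf a ha

lemma exists_mul_norm_le_integral_exp_inner [IsProbabilityMeasure μ] (hK : IsCompact K)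
    (hμK : μ Kᶜ = 0) {y : E} (hy : y ∈ interior (convexHull ℝ μ.support)) :
    ∃ c > 0, ∀ ξ : E, c * ‖ξ‖ ≤ ∫ x, exp ⟪ξ, x - y⟫ ∂μ := by
  have hint : ∀ {f : E → ℝ}, Continuous f → Integrable f μ := fun hf =>
    hf.integrable_of_measure_compl_eq_zero hK hμK
  let g : E → ℝ := fun θ => ∫ x, max ⟪θ, x - y⟫ 0 ∂μ
  have hlip : ∀ θ η : E, |g θ - g η| ≤ (∫ x, ‖x - y‖ ∂μ) * ‖θ - η‖ := by
    intro θ η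
    rw [← integral_sub (hint (by fun_prop)) (hint (by fun_prop)), ← integral_mul_const]
    refine abs_integral_le_integral_abs.trans
      (integral_mono (hint (by fun_prop)) (hint (by fun_prop)) fun x => ?_)
    refine (abs_max_sub_max_le_abs _ _ _).trans ?_
    rw [← inner_sub_left, mul_comm]
    exact abs_real_inner_le_norm _ _
  have hg : Continuous g :=
    (LipschitzWith.of_dist_le' fun θ η => by
      simpa only [dist_eq_norm, Real.norm_eq_abs] using hlip θ η).continuous
  have hpos : ∀ θ, θ ≠ 0 → 0 < g θ := by
    intro θ hθ
    obtain ⟨x, hx, hxpos⟩ := exists_inner_pos_of_mem_interior_convexHull hy hθ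
    have hcont : Continuous fun x : E => max ⟪θ, x - y⟫ 0 := by fun_prop
    refine (integral_pos_iff_support_of_nonneg (fun x => le_max_right _ _) (hint hcont)).2 ?_
    refine (Measure.mem_support_iff_forall x).1 hx _ (hcont.isOpen_support.mem_nhds ?_)
    exact (lt_max_of_lt_left hxpos).ne'
  have hhom : ∀ (t : ℝ) (θ : E), 0 ≤ t → g (t • θ) = t * g θ := by
    intro t θ ht
    simp only [g, ← integral_const_mul, real_inner_smul_left, mul_max_of_nonneg _ _ ht, mul_zero]
  obtain ⟨c, hc, hcg⟩ := exists_mul_norm_le_of_continuous_homogeneous hg hpos hhom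
  refine ⟨c, hc, fun ξ => (hcg ξ).trans
    (integral_mono (hint (by fun_prop)) (hint (by fun_prop)) fun x => ?_)⟩
  exact max_le (by linarith [add_one_le_exp ⟪ξ, x - y⟫]) (exp_pos _).le

lemma exists_hasGradientAt_log_integral_exp_inner [IsProbabilityMeasure μ] (hK : IsCompact K)
    (hμK : μ Kᶜ = 0) {y : E} (hy : y ∈ interior (convexHull ℝ μ.support)) :
    ∃ ξ, HasGradientAt (fun η : E => log (∫ x, exp ⟪η, x⟫ ∂μ)) y ξ := by
  obtain ⟨c, hc, hcoer⟩ := exists_mul_norm_le_integral_exp_inner hK hμK hy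
  let G : E → ℝ := fun ξ => exp (-⟪ξ, y⟫) * ∫ x, exp ⟪ξ, x⟫ ∂μ
  have hG : ∀ ξ, G ξ = ∫ x, exp ⟪ξ, x - y⟫ ∂μ := by
    intro ξ
    simp only [G, ← integral_const_mul, inner_sub_right, ← exp_add, neg_add_eq_sub]
  have hZ : Continuous fun ξ : E => ∫ x, exp ⟪ξ, x⟫ ∂μ :=
    continuous_iff_continuousAt.2 fun ξ => (hasFDerivAt_integral_exp_inner hK hμK ξ).continuousAt
  have hlim : Tendsto G (cocompact E) atTop :=
    tendsto_atTop_mono (fun ξ => (hcoer ξ).trans (hG ξ).ge)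
      ((tendsto_norm_cocompact_atTop (E := E)).const_mul_atTop hc)
  obtain ⟨ξ, hξ⟩ := Continuous.exists_forall_le (by fun_prop : Continuous G) hlim
  refine ⟨ξ, ?_⟩
  have hlogG : ∀ η, log (G η) = log (∫ x, exp ⟪η, x⟫ ∂μ) - ⟪y, η⟫ := by
    intro η
    rw [log_mul (exp_pos _).ne' (integral_exp_inner_pos hK hμK η).ne', log_exp, real_inner_comm]
    ring
  have hmin : IsLocalMin (fun η => log (∫ x, exp ⟪η, x⟫ ∂μ) - innerSL ℝ y η) ξ := by
    refine Eventually.of_forall fun η => ?_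
    simp only [innerSL_apply_apply, ← hlogG]
    exact log_le_log (mul_pos (exp_pos _) (integral_exp_inner_pos hK hμK ξ)) (hξ η)
  have hgrad := hasGradientAt_log_integral_exp_inner hK hμK ξ
  have hzero := hmin.hasFDerivAt_eq_zero (hgrad.hasFDerivAt.sub (innerSL ℝ y).hasFDerivAt)
  rw [hasGradientAt_iff_hasFDerivAt]
  exact (sub_eq_zero.1 hzero) ▸ hgrad.hasFDerivAt

end Laplace

lemma msupport_eq_support {n : ℕ} (μ : Measure (EucSp n)) : msupport μ = μ.support := by
  ext x
  simp [msupport, Measure.mem_support_iff_forall, pos_iff_ne_zero]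

/-- For a compactly-supported Borel probability measure μ on ℝⁿ whose support is not
contained in a hyperplane, the image of the gradient map ∇Λ_μ : ℝⁿ → ℝⁿ equals the
interior of the convex hull of the support of μ. -/
theorem range_gradient_logLaplace (n : ℕ) (μ : Measure (EucSp n))
    (hprob : IsProbabilityMeasure μ) (hcpt : IsCompactlySupported μ)
    (hhyp : SuppNotInHyperplane μ) :
    Set.range (fun ξ => gradient (logLaplace μ) ξ) =
      interior (convexHull ℝ (msupport μ)) := by
  obtain ⟨K, hK, hμK⟩ := hcpt
  rw [msupport_eq_support]
  have hS : ∀ (θ : EucSp n) (c : ℝ), μ.support ⊆ {x | ⟪θ, x⟫ = c} → θ = 0 := by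
    intro θ c h
    by_contra hθ
    exact hhyp ⟨θ, c, hθ, (msupport_eq_support μ).trans_subset h⟩
  refine Subset.antisymm ?_ fun y hy => ?_
  · rintro _ ⟨ξ, rfl⟩
    have hgrad : HasGradientAt (logLaplace μ) _ ξ := hasGradientAt_log_integral_exp_inner hK hμK ξ
    simpa only [hgrad.gradient] using exp_barycenter_mem_interior_convexHull_support hK hμK hS ξ
  · obtain ⟨ξ, hξ⟩ := exists_hasGradientAt_log_integral_exp_inner hK hμK hy
    exact ⟨ξ, HasGradientAt.gradient (f := logLaplace μ) hξ⟩
end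
end
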